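/- For 2 ≤ p < ∞ and k ∈ ℕ, the Rademacher type 2 constant of the Schatten p-class C^k_p of k×k matrices satisfies T_2(C^k_p) ≤ C√p for a universal constant C. -/

import Mathlib

open scoped ComplexOrder

/-- The singular values of a complex `k × k` matrix: square roots of eigenvalues of `xᴴx`. -/
noncomputable def singVals {k : ℕ} (x : Matrix (Fin k) (Fin k) ℂ) : Fin k → ℝ :=
  fun i => Real.sqrt ((Matrix.posSemidef_conjTranspose_mul_self x).1.eigenvalues i)

/-- The Schatten `p`-norm `‖x‖_p = (Tr |x|^p)^{1/p}` of a `k × k` complex matrix. -/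
noncomputable def schattenNorm {k : ℕ} (p : ℝ) (x : Matrix (Fin k) (Fin k) ℂ) : ℝ :=
  (∑ i : Fin k, singVals x i ^ p) ^ (1 / p)

open Matrix

/-! ### Scalar inequalities -/

/-- The tangent line inequality for `t ↦ t ^ r` on the nonnegative reals. -/
lemma rpow_add_tangent_le {x y r : ℝ} (hx : 0 ≤ x) (hy : 0 ≤ y) (hr : 1 ≤ r) :
    x ^ r + r * x ^ (r - 1) * (y - x) ≤ y ^ r := by
  rcases hx.eq_or_lt with rfl | hx
  · rcases hr.eq_or_lt with rfl | hr
    · simp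
    · rw [Real.zero_rpow (by linarith), Real.zero_rpow (by linarith)]
      simpa using Real.rpow_nonneg hy r
  · have h := one_add_mul_self_le_rpow_one_add (s := y / x - 1)
      (by linarith [div_nonneg hy hx.le]) hr
    have e : 1 + (y / x - 1) = y / x := by ring
    rw [e, Real.div_rpow hy hx.le, le_div_iff₀ (by positivity)] at h
    have e2 : x ^ r = x ^ (r - 1) * x := by
      rw [← Real.rpow_add_one hx.ne']; congr 1; ring
    have e3 : (1 + r * (y / x - 1)) * x ^ r = x ^ r + r * x ^ (r - 1) * (y - x) := by
      rw [e2]; field_simp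
    linarith

lemma abs_rpow_sub_two_mul {p : ℝ} (hp : 2 ≤ p) (a : ℝ) :
    |a| ^ (p - 2) * |a| = |a| ^ (p - 1) := by
  rcases eq_or_ne a 0 with rfl | ha
  · simp [Real.zero_rpow (show p - 1 ≠ 0 by linarith)]
  · rw [← Real.rpow_add_one (abs_ne_zero.2 ha)]; congr 1; ring

lemma abs_rpow_sub_one_mul {p : ℝ} (hp : 2 ≤ p) (a : ℝ) :
    |a| ^ (p - 1) * |a| = |a| ^ p := by
  rcases eq_or_ne a 0 with rfl | ha
  · simp [Real.zero_rpow (show p ≠ 0 by linarith)]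
  · rw [← Real.rpow_add_one (abs_ne_zero.2 ha)]; congr 1; ring

/-- The function `t ↦ |t| ^ p` lies above its tangent lines. -/
lemma abs_rpow_sub_le {p : ℝ} (hp : 2 ≤ p) (a b : ℝ) :
    |a| ^ p - |b| ^ p ≤ p * (|a| ^ (p - 2) * a) * (a - b) := by
  have h := rpow_add_tangent_le (abs_nonneg a) (abs_nonneg b) (show 1 ≤ p by linarith)
  rw [← abs_rpow_sub_two_mul hp] at h
  have h0 : 0 ≤ p * |a| ^ (p - 2) := by positivity
  have h1 : 0 ≤ |a| * |b| - a * b := by rw [← abs_mul]; linarith [le_abs_self (a * b)]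
  have h2 : |a| * |a| = a * a := abs_mul_abs_self a
  have h3 := mul_nonneg h0 h1
  have e : p * (|a| ^ (p - 2) * |a|) * (|b| - |a|)
      = p * |a| ^ (p - 2) * (|a| * |b| - a * b) - p * (|a| ^ (p - 2) * a) * (a - b) := by
    linear_combination (-(p * |a| ^ (p - 2))) * h2
  linarith

lemma rpow_sub_rpow_le {p a b : ℝ} (hp : 2 ≤ p) (hb : 0 ≤ b) (hab : b ≤ a) :
    a ^ (p - 1) - b ^ (p - 1) ≤ (p - 1) * a ^ (p - 2) * (a - b) := by
  have h := rpow_add_tangent_le (hb.trans hab) hb (show 1 ≤ p - 1 by linarith)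
  rw [show p - 1 - 1 = p - 2 by ring] at h
  linarith

/-- A Lipschitz-type estimate for the derivative of `t ↦ |t| ^ p`. -/
lemma signed_rpow_sub_mul_le {p : ℝ} (hp : 2 ≤ p) (a b : ℝ) :
    (|a| ^ (p - 2) * a - |b| ^ (p - 2) * b) * (a - b)
      ≤ (p - 1) * (|a| ^ (p - 2) + |b| ^ (p - 2)) * (a - b) ^ 2 := by
  have same : ∀ a b : ℝ, 0 ≤ b → b ≤ a → (|a| ^ (p - 2) * a - |b| ^ (p - 2) * b) * (a - b)
      ≤ (p - 1) * (|a| ^ (p - 2) + |b| ^ (p - 2)) * (a - b) ^ 2 := by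
    intro a b hb hab
    have ha := hb.trans hab
    have h := rpow_sub_rpow_le hp hb hab
    have ea := abs_rpow_sub_two_mul hp a
    have eb := abs_rpow_sub_two_mul hp b
    rw [abs_of_nonneg ha] at ea ⊢
    rw [abs_of_nonneg hb] at eb ⊢
    rw [ea, eb]
    have h1 := mul_le_mul_of_nonneg_right h (sub_nonneg.2 hab)
    have h2 : 0 ≤ (p - 1) * b ^ (p - 2) * (a - b) ^ 2 :=
      mul_nonneg (mul_nonneg (by linarith) (by positivity)) (sq_nonneg _)
    nlinarith
  have opp : ∀ a b : ℝ, 0 ≤ a → b ≤ 0 → (|a| ^ (p - 2) * a - |b| ^ (p - 2) * b) * (a - b)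
      ≤ (p - 1) * (|a| ^ (p - 2) + |b| ^ (p - 2)) * (a - b) ^ 2 := by
    intro a b ha hb
    have hA : 0 ≤ |a| ^ (p - 2) := by positivity
    have hB : 0 ≤ |b| ^ (p - 2) := by positivity
    have h1 : |a| ^ (p - 2) * a - |b| ^ (p - 2) * b
        ≤ (|a| ^ (p - 2) + |b| ^ (p - 2)) * (a - b) := by
      nlinarith [mul_nonneg hB ha, mul_nonneg hA (neg_nonneg.2 hb)]
    have h2 := mul_le_mul_of_nonneg_right h1 (show 0 ≤ a - b by linarith)
    have h3 : 0 ≤ (|a| ^ (p - 2) + |b| ^ (p - 2)) * (a - b) ^ 2 := by positivity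
    nlinarith
  rcases le_total 0 a with ha | ha <;> rcases le_total 0 b with hb | hb
  · rcases le_total b a with h | h
    · exact same a b hb h
    · have := same b a ha h
      linarith
  · exact opp a b ha hb
  · have := opp b a hb ha
    linarith
  · rcases le_total b a with h | h
    · have := same (-b) (-a) (by linarith) (by linarith)
      simp only [abs_neg] at this
      linarith
    · have := same (-a) (-b) (by linarith) (by linarith)
      simp only [abs_neg] at this
      linarith

/-- A second order Taylor bound for `t ↦ |t| ^ p`. -/
lemma abs_rpow_taylor {p : ℝ} (hp : 2 ≤ p) (a b : ℝ) :
    |a| ^ p - |b| ^ p - p * (|b| ^ (p - 2) * b) * (a - b)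
      ≤ p * (p - 1) * ((|a| ^ (p - 2) + |b| ^ (p - 2)) * (a - b) ^ 2) := by
  have h1 := abs_rpow_sub_le hp a b
  have h2 := mul_le_mul_of_nonneg_left (signed_rpow_sub_mul_le hp a b) (show 0 ≤ p by linarith)
  linarith

lemma add_rpow_le_of_mul_le {p c d : ℝ} (hp : 2 ≤ p) (hc : 0 ≤ c) (hd : 0 ≤ d)
    (h : p * d ≤ c) : (c + d) ^ (p - 2) ≤ 3 * c ^ (p - 2) := by
  have hp0 : 0 < p := by linarith
  have h1 : c + d ≤ c * Real.exp (1 / p) := by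
    have h2 := Real.add_one_le_exp (1 / p)
    have h3 : d ≤ c * (1 / p) := by rw [mul_one_div, le_div_iff₀ hp0]; linarith
    nlinarith
  calc (c + d) ^ (p - 2) ≤ (c * Real.exp (1 / p)) ^ (p - 2) :=
        Real.rpow_le_rpow (by positivity) h1 (by linarith)
    _ = c ^ (p - 2) * Real.exp (1 / p * (p - 2)) := by
        rw [Real.mul_rpow hc (Real.exp_nonneg _), Real.exp_mul]
    _ ≤ c ^ (p - 2) * 3 := by
        refine mul_le_mul_of_nonneg_left ?_ (by positivity)
        have : 1 / p * (p - 2) ≤ 1 := by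
          rw [one_div_mul_eq_div, div_le_one hp0]; linarith
        exact (Real.exp_le_exp.2 this).trans Real.exp_one_lt_three.le
    _ = _ := by ring

/-- Passing from a `p`-th power smoothness estimate to a quadratic one. -/
lemma sq_smoothness_of_rpow {p a b c d : ℝ} (hp : 2 ≤ p) (ha : 0 ≤ a) (hb : 0 ≤ b)
    (hc : 0 ≤ c) (hd : 0 ≤ d) (hac : a ≤ c + d) (hbc : b ≤ c + d)
    (h : a ^ p + b ^ p - 2 * c ^ p
      ≤ p * (p - 1) * ((a ^ (p - 2) + b ^ (p - 2) + 2 * c ^ (p - 2)) * d ^ 2)) :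
    (a ^ 2 + b ^ 2) / 2 ≤ c ^ 2 + 8 * p * d ^ 2 := by
  have ha2 : a ^ 2 ≤ (c + d) ^ 2 := pow_le_pow_left₀ ha hac 2
  have hb2 : b ^ 2 ≤ (c + d) ^ 2 := pow_le_pow_left₀ hb hbc 2
  have hpd : 0 ≤ p * d ^ 2 := by positivity
  rcases le_or_gt c (p * d) with hcd | hcd
  · nlinarith [mul_le_mul_of_nonneg_right hcd hd]
  · have hc0 : 0 < c := lt_of_le_of_lt (by positivity) hcd
    have h3 := add_rpow_le_of_mul_le hp hc hd hcd.le
    have ha3 : a ^ (p - 2) ≤ 3 * c ^ (p - 2) :=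
      (Real.rpow_le_rpow ha hac (by linarith)).trans h3
    have hb3 : b ^ (p - 2) ≤ 3 * c ^ (p - 2) :=
      (Real.rpow_le_rpow hb hbc (by linarith)).trans h3
    have key : ∀ t : ℝ, 0 ≤ t → c ^ p + p / 2 * c ^ (p - 2) * (t ^ 2 - c ^ 2) ≤ t ^ p := by
      intro t ht
      have := rpow_add_tangent_le (sq_nonneg c) (sq_nonneg t) (show 1 ≤ p / 2 by linarith)
      simp only [← Real.rpow_natCast, ← Real.rpow_mul hc, ← Real.rpow_mul ht] at this ⊢
      convert this using 3
      · push_cast; ring_nf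
      · push_cast; ring_nf
      · push_cast; ring_nf
    have hka := key a ha
    have hkb := key b hb
    have hC : 0 < c ^ (p - 2) := by positivity
    have h4 : p * (p - 1) * ((a ^ (p - 2) + b ^ (p - 2) + 2 * c ^ (p - 2)) * d ^ 2)
        ≤ p * (p - 1) * (8 * c ^ (p - 2) * d ^ 2) := by
      refine mul_le_mul_of_nonneg_left ?_ (mul_nonneg (by linarith) (by linarith))
      exact mul_le_mul_of_nonneg_right (by linarith) (sq_nonneg d)
    have h5 : p * c ^ (p - 2) * ((a ^ 2 + b ^ 2) / 2 - c ^ 2)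
        ≤ p * c ^ (p - 2) * (8 * (p - 1) * d ^ 2) := by linarith
    have h6 := le_of_mul_le_mul_left h5 (by positivity)
    nlinarith [sq_nonneg d]

/-- Hölder's inequality with respect to a doubly stochastic weight. -/
lemma sum_doublyStochastic_rpow_le {n : Type*} [Fintype n] {w : n → n → ℝ}
    (hw : ∀ i j, 0 ≤ w i j) (hrow : ∀ i, ∑ j, w i j = 1) (hcol : ∀ j, ∑ i, w i j = 1)
    {α β : n → ℝ} (hα : ∀ i, 0 ≤ α i) (hβ : ∀ j, 0 ≤ β j) {θ : ℝ} (h0 : 0 < θ) (h1 : θ ≤ 1) :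
    ∑ i, ∑ j, w i j * (α i ^ (1 - θ) * β j ^ θ) ≤ (∑ i, α i) ^ (1 - θ) * (∑ j, β j) ^ θ := by
  have sumα : ∑ i, ∑ j, w i j * α i = ∑ i, α i := by
    simp only [← Finset.sum_mul, hrow, one_mul]
  have sumβ : ∑ i, ∑ j, w i j * β j = ∑ j, β j := by
    rw [Finset.sum_comm]; simp only [← Finset.sum_mul, hcol, one_mul]
  rcases h1.eq_or_lt with rfl | h1
  · simp [sumβ]
  have hP : 0 ≤ ∑ i, α i := Finset.sum_nonneg fun i _ => hα i
  have hQ : 0 ≤ ∑ j, β j := Finset.sum_nonneg fun j _ => hβ j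
  rcases hP.eq_or_lt with hP0 | hP
  · have hz : ∀ i, α i = 0 := fun i =>
      (Finset.sum_eq_zero_iff_of_nonneg fun i _ => hα i).1 hP0.symm i (Finset.mem_univ i)
    simp [hz, Real.zero_rpow (show 1 - θ ≠ 0 by linarith)]
  rcases hQ.eq_or_lt with hQ0 | hQ
  · have hz : ∀ i, β i = 0 := fun i =>
      (Finset.sum_eq_zero_iff_of_nonneg fun i _ => hβ i).1 hQ0.symm i (Finset.mem_univ i)
    simp [hz, Real.zero_rpow h0.ne']
  set P := ∑ i, α i
  set Q := ∑ j, β j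
  have pt : ∀ i j, α i ^ (1 - θ) * β j ^ θ
      ≤ P ^ (1 - θ) * Q ^ θ * ((1 - θ) * (α i / P) + θ * (β j / Q)) := by
    intro i j
    have h := Real.geom_mean_le_arith_mean2_weighted (show 0 ≤ 1 - θ by linarith) h0.le
      (div_nonneg (hα i) hP.le) (div_nonneg (hβ j) hQ.le) (by ring)
    rw [Real.div_rpow (hα i) hP.le, Real.div_rpow (hβ j) hQ.le] at h
    have hPp : 0 < P ^ (1 - θ) := by positivity
    have hQp : 0 < Q ^ θ := by positivity
    have h2 := mul_le_mul_of_nonneg_left h (mul_pos hPp hQp).le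
    refine le_of_eq_of_le ?_ h2
    field_simp
  calc ∑ i, ∑ j, w i j * (α i ^ (1 - θ) * β j ^ θ)
      ≤ ∑ i, ∑ j, w i j * (P ^ (1 - θ) * Q ^ θ * ((1 - θ) * (α i / P) + θ * (β j / Q))) :=
        Finset.sum_le_sum fun i _ => Finset.sum_le_sum fun j _ =>
          mul_le_mul_of_nonneg_left (pt i j) (hw i j)
    _ = P ^ (1 - θ) * Q ^ θ * ((1 - θ) * ((∑ i, ∑ j, w i j * α i) / P)
          + θ * ((∑ i, ∑ j, w i j * β j) / Q)) := by
        simp only [Finset.sum_div, Finset.mul_sum, ← Finset.sum_add_distrib]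
        refine Finset.sum_congr rfl fun i _ => Finset.sum_congr rfl fun j _ => ?_
        ring
    _ = P ^ (1 - θ) * Q ^ θ := by
        rw [sumα, sumβ, div_self hP.ne', div_self hQ.ne']; ring

/-! ### Unitary diagonalizations -/

/-- The `ℓ^p` norm of a real vector; for the eigenvalues of a Hermitian matrix this is its
Schatten norm. -/
noncomputable def vecLpNorm {n : Type*} [Fintype n] (p : ℝ) (a : n → ℝ) : ℝ :=
  (∑ i, |a i| ^ p) ^ (1 / p)

lemma sum_abs_rpow_nonneg {n : Type*} [Fintype n] (p : ℝ) (a : n → ℝ) :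
    0 ≤ ∑ i, |a i| ^ p :=
  Finset.sum_nonneg fun i _ => by positivity

lemma vecLpNorm_nonneg {n : Type*} [Fintype n] (p : ℝ) (a : n → ℝ) : 0 ≤ vecLpNorm p a :=
  Real.rpow_nonneg (sum_abs_rpow_nonneg p a) _

lemma vecLpNorm_neg {n : Type*} [Fintype n] (p : ℝ) (a : n → ℝ) : vecLpNorm p (-a) = vecLpNorm p a := by
  simp [vecLpNorm]

lemma sum_rpow_eq_vecLpNorm {n : Type*} [Fintype n] {p : ℝ} (r : ℝ) (a : n → ℝ) :
    (∑ i, |a i| ^ p) ^ (r / p) = vecLpNorm p a ^ r := by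
  rw [vecLpNorm, ← Real.rpow_mul (sum_abs_rpow_nonneg p a), one_div_mul_eq_div]

lemma vecLpNorm_rpow {n : Type*} [Fintype n] {p : ℝ} (hp : 2 ≤ p) (a : n → ℝ) :
    vecLpNorm p a ^ p = ∑ i, |a i| ^ p := by
  rw [← sum_rpow_eq_vecLpNorm, div_self (by linarith), Real.rpow_one]

lemma norm_overlap_comm {n : Type*} [Fintype n] (U V : Matrix n n ℂ) (i j : n) :
    ‖(Uᴴ * V) i j‖ = ‖(Vᴴ * U) j i‖ := by
  have : Vᴴ * U = (Uᴴ * V)ᴴ := by simp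
  rw [this, conjTranspose_apply, norm_star]

/-- `A = U diag(a) Uᴴ` with `U` unitary and `a` real. -/
structure IsDiagonalization {n : Type*} [Fintype n] [DecidableEq n]
    (U : Matrix n n ℂ) (a : n → ℝ) (A : Matrix n n ℂ) : Prop where
  star_mul : Uᴴ * U = 1
  mul_star : U * Uᴴ = 1
  eq : A = U * diagonal (fun i => (a i : ℂ)) * Uᴴ

namespace IsDiagonalization

variable {n : Type*} [Fintype n] [DecidableEq n] {U V Z A B D : Matrix n n ℂ} {a b d : n → ℝ}

lemma of_isHermitian (hA : A.IsHermitian) :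
    IsDiagonalization (hA.eigenvectorUnitary : Matrix n n ℂ) hA.eigenvalues A where
  star_mul := Unitary.coe_star_mul_self hA.eigenvectorUnitary
  mul_star := Unitary.coe_mul_star_self hA.eigenvectorUnitary
  eq := hA.spectral_theorem

lemma congr (h : IsDiagonalization U a A) (hAB : A = B) : IsDiagonalization U a B :=
  hAB ▸ h

lemma neg (h : IsDiagonalization U a A) : IsDiagonalization U (-a) (-A) where
  star_mul := h.star_mul
  mul_star := h.mul_star
  eq := by
    rw [h.eq, ← neg_mul, ← mul_neg, diagonal_neg]
    congr 3
    ext i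
    simp

lemma mul_self (h : IsDiagonalization U a A) :
    IsDiagonalization U (fun i => a i ^ 2) (A * A) where
  star_mul := h.star_mul
  mul_star := h.mul_star
  eq := by
    rw [h.eq]
    calc _ = U * diagonal (fun i => (a i : ℂ)) * (Uᴴ * U) * diagonal (fun i => (a i : ℂ)) * Uᴴ := by
          simp only [Matrix.mul_assoc]
      _ = _ := by
          rw [h.star_mul, Matrix.mul_one, Matrix.mul_assoc U, diagonal_mul_diagonal]
          congr 3
          ext i
          simp [sq]

lemma conjTranspose_eq (h : IsDiagonalization U a A) : Aᴴ = A := by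
  rw [h.eq]
  simp only [conjTranspose_mul, conjTranspose_conjTranspose, diagonal_conjTranspose,
    Matrix.mul_assoc]
  congr 3
  ext i
  simp

lemma roots_charpoly (h : IsDiagonalization U a A) :
    A.charpoly.roots = Finset.univ.val.map fun i => (a i : ℂ) := by
  rw [h.eq, charpoly_mul_comm, ← Matrix.mul_assoc, h.star_mul, Matrix.one_mul, charpoly_diagonal,
    Polynomial.roots_prod]
  · simp
  · simp [Finset.prod_ne_zero_iff, Polynomial.X_sub_C_ne_zero]

lemma star_mul_eq (h : IsDiagonalization U a A) :
    Uᴴ * A = diagonal (fun i => (a i : ℂ)) * Uᴴ := by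
  rw [h.eq, ← Matrix.mul_assoc, ← Matrix.mul_assoc, h.star_mul, Matrix.one_mul]

lemma mul_eq (h : IsDiagonalization U a A) :
    A * U = U * diagonal (fun i => (a i : ℂ)) := by
  rw [h.eq, Matrix.mul_assoc, h.star_mul, Matrix.mul_one]

lemma star_mul_mul_apply (h : IsDiagonalization V b B) (U : Matrix n n ℂ) (i : n) :
    ((Uᴴ * B * U) i i).re = ∑ j, ‖(Uᴴ * V) i j‖ ^ 2 * b j := by
  have e : Uᴴ * B * U = (Uᴴ * V) * diagonal (fun j => (b j : ℂ)) * (Uᴴ * V)ᴴ := by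
    rw [h.eq]
    simp only [conjTranspose_mul, conjTranspose_conjTranspose, Matrix.mul_assoc]
  rw [e, Matrix.mul_apply, Complex.re_sum]
  refine Finset.sum_congr rfl fun j _ => ?_
  rw [mul_diagonal, conjTranspose_apply, mul_right_comm, ← starRingEnd_apply, Complex.mul_conj,
    ← Complex.ofReal_mul, Complex.ofReal_re, Complex.normSq_eq_norm_sq]

lemma star_mul_self_apply (h : IsDiagonalization U a A) (i : n) :
    ((Uᴴ * A * U) i i).re = a i := by
  rw [h.star_mul_eq, Matrix.mul_assoc, h.star_mul]
  simp

lemma sum_overlap_right (hU : IsDiagonalization U a A) (hV : IsDiagonalization V b B) (i : n) :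
    ∑ j, ‖(Uᴴ * V) i j‖ ^ 2 = 1 := by
  have h1 : IsDiagonalization V (fun _ => 1) 1 := ⟨hV.star_mul, hV.mul_star, by simp [hV.mul_star]⟩
  have := h1.star_mul_mul_apply U i
  simpa [hU.star_mul] using this.symm

lemma sum_overlap_left (hU : IsDiagonalization U a A) (hV : IsDiagonalization V b B) (j : n) :
    ∑ i, ‖(Uᴴ * V) i j‖ ^ 2 = 1 := by
  simp only [norm_overlap_comm U V]
  exact hV.sum_overlap_right hU j

/-- Hölder's inequality for traces of functions of two Hermitian matrices. -/
lemma sum_rpow_mul_le (hU : IsDiagonalization U a A) (hV : IsDiagonalization V b B)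
    {α β : n → ℝ} (hα : ∀ i, 0 ≤ α i) (hβ : ∀ j, 0 ≤ β j) {θ : ℝ} (h0 : 0 < θ) (h1 : θ ≤ 1) :
    ∑ i, α i ^ (1 - θ) * ∑ j, ‖(Uᴴ * V) i j‖ ^ 2 * β j ^ θ
      ≤ (∑ i, α i) ^ (1 - θ) * (∑ j, β j) ^ θ := by
  refine le_of_eq_of_le ?_ (sum_doublyStochastic_rpow_le (w := fun i j => ‖(Uᴴ * V) i j‖ ^ 2)
    (fun i j => sq_nonneg _) (hU.sum_overlap_right hV) (hU.sum_overlap_left hV) hα hβ h0 h1)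
  refine Finset.sum_congr rfl fun i _ => ?_
  rw [Finset.mul_sum]
  exact Finset.sum_congr rfl fun j _ => by ring

lemma star_mul_sub_mul_apply (hA : IsDiagonalization U a A) (hB : IsDiagonalization V b B)
    (i j : n) : (Uᴴ * (A - B) * V) i j = ((a i - b j : ℝ) : ℂ) * (Uᴴ * V) i j := by
  rw [Matrix.mul_sub, Matrix.sub_mul, hA.star_mul_eq, Matrix.mul_assoc Uᴴ B, hB.mul_eq,
    Matrix.mul_assoc, ← Matrix.mul_assoc Uᴴ V]
  rw [Matrix.sub_apply, diagonal_mul, mul_diagonal]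
  push_cast
  ring

lemma sum_overlap_mul_sq (hA : IsDiagonalization U a A) (hB : IsDiagonalization V b B)
    (hD : IsDiagonalization Z d (A - B)) (i : n) :
    ∑ j, ‖(Uᴴ * V) i j‖ ^ 2 * (a i - b j) ^ 2 = ∑ j, ‖(Uᴴ * Z) i j‖ ^ 2 * d j ^ 2 := by
  have e : Uᴴ * ((A - B) * (A - B)) * U = (Uᴴ * (A - B) * V) * (Uᴴ * (A - B) * V)ᴴ := by
    simp only [conjTranspose_mul, conjTranspose_conjTranspose, hD.conjTranspose_eq]
    calc _ = Uᴴ * (A - B) * (1 : Matrix n n ℂ) * ((A - B) * U) := by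
          simp only [Matrix.mul_assoc, Matrix.one_mul]
      _ = _ := by rw [← hB.mul_star]; simp only [Matrix.mul_assoc]
  rw [← hD.mul_self.star_mul_mul_apply U i, e, Matrix.mul_apply, Complex.re_sum]
  refine Finset.sum_congr rfl fun j _ => ?_
  rw [conjTranspose_apply, ← starRingEnd_apply, Complex.mul_conj, Complex.ofReal_re,
    Complex.normSq_eq_norm_sq, hA.star_mul_sub_mul_apply hB, norm_mul, Complex.norm_real, mul_pow,
    Real.norm_eq_abs, sq_abs]
  ring

/-- Hölder's inequality in the form `∑ |aᵢ| ^ (p - r) * (Uᴴ |B| ^ r U)ᵢᵢ ≤ ‖A‖ ^ (p - r) ‖B‖ ^ r`. -/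
lemma holder (hU : IsDiagonalization U a A) (hV : IsDiagonalization V b B) {p r : ℝ} (hp : 2 ≤ p)
    (hr : 0 < r) (hrp : r ≤ p) :
    ∑ i, |a i| ^ (p - r) * ∑ j, ‖(Uᴴ * V) i j‖ ^ 2 * |b j| ^ r
      ≤ vecLpNorm p a ^ (p - r) * vecLpNorm p b ^ r := by
  have hp0 : 0 < p := by linarith
  have h := hU.sum_rpow_mul_le hV (α := fun i => |a i| ^ p) (β := fun j => |b j| ^ p)
    (fun i => by positivity) (fun j => by positivity) (θ := r / p) (by positivity)
    ((div_le_one hp0).2 hrp)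
  have e : 1 - r / p = (p - r) / p := by field_simp
  have e1 : p * ((p - r) / p) = p - r := by field_simp
  have e2 : p * (r / p) = r := by field_simp
  rw [e, sum_rpow_eq_vecLpNorm, sum_rpow_eq_vecLpNorm] at h
  simpa only [← Real.rpow_mul (abs_nonneg _), e1, e2] using h

/-- `Tr (|A| ^ (p - 2) A B) ≤ ‖A‖ ^ (p - 1) ‖B‖`. -/
lemma sum_signed_rpow_mul_le (hU : IsDiagonalization U a A) (hV : IsDiagonalization V b B)
    {p : ℝ} (hp : 2 ≤ p) :
    ∑ i, |a i| ^ (p - 2) * a i * ((Uᴴ * B * U) i i).re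
      ≤ vecLpNorm p a ^ (p - 1) * vecLpNorm p b := by
  have h := hU.holder hV hp one_pos (by linarith)
  rw [Real.rpow_one] at h
  refine le_trans (Finset.sum_le_sum fun i _ => ?_) h
  rw [hV.star_mul_mul_apply U i, ← abs_rpow_sub_two_mul hp]
  refine (le_abs_self _).trans ?_
  rw [abs_mul, abs_mul, abs_of_nonneg (show 0 ≤ |a i| ^ (p - 2) by positivity)]
  refine mul_le_mul_of_nonneg_left ?_ (by positivity)
  refine (Finset.abs_sum_le_sum_abs _ _).trans (Finset.sum_le_sum fun j _ => ?_)
  rw [abs_mul, abs_of_nonneg (sq_nonneg ‖(Uᴴ * V) i j‖), Real.rpow_one]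

/-- The triangle inequality for the Schatten norm of Hermitian matrices. -/
lemma vecLpNorm_add_le (hU : IsDiagonalization U a (A + B)) (hA : IsDiagonalization V b A)
    (hB : IsDiagonalization Z d B) {p : ℝ} (hp : 2 ≤ p) :
    vecLpNorm p a ≤ vecLpNorm p b + vecLpNorm p d := by
  rcases (vecLpNorm_nonneg p a).eq_or_lt with h0 | h0
  · rw [← h0]; exact add_nonneg (vecLpNorm_nonneg p b) (vecLpNorm_nonneg p d)
  have h1 := hU.sum_signed_rpow_mul_le hA hp
  have h2 := hU.sum_signed_rpow_mul_le hB hp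
  have e : vecLpNorm p a ^ p = ∑ i, |a i| ^ (p - 2) * a i * ((Uᴴ * A * U) i i).re
      + ∑ i, |a i| ^ (p - 2) * a i * ((Uᴴ * B * U) i i).re := by
    rw [vecLpNorm_rpow hp, ← Finset.sum_add_distrib]
    refine Finset.sum_congr rfl fun i _ => ?_
    have := hU.star_mul_self_apply i
    rw [Matrix.mul_add, Matrix.add_mul, Matrix.add_apply, Complex.add_re] at this
    rw [← mul_add, this, mul_assoc, ← abs_mul_abs_self (a i), ← mul_assoc,
      abs_rpow_sub_two_mul hp, abs_rpow_sub_one_mul hp]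
  have e2 : vecLpNorm p a ^ p = vecLpNorm p a ^ (p - 1) * vecLpNorm p a := by
    rw [← Real.rpow_add_one h0.ne']; congr 1; ring
  have h3 : vecLpNorm p a ^ (p - 1) * vecLpNorm p a
      ≤ vecLpNorm p a ^ (p - 1) * (vecLpNorm p b + vecLpNorm p d) := by
    rw [← e2]; linarith
  exact le_of_mul_le_mul_left h3 (by positivity)

/-- A second order Taylor bound for `A ↦ Tr |A| ^ p` on Hermitian matrices. -/
lemma vecLpNorm_rpow_taylor (hA : IsDiagonalization U a A) (hB : IsDiagonalization V b B)
    (hD : IsDiagonalization Z d (A - B)) {p : ℝ} (hp : 2 ≤ p) :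
    vecLpNorm p a ^ p - vecLpNorm p b ^ p
        - p * ∑ j, |b j| ^ (p - 2) * b j * ((Vᴴ * (A - B) * V) j j).re
      ≤ p * (p - 1) * ((vecLpNorm p a ^ (p - 2) + vecLpNorm p b ^ (p - 2)) * vecLpNorm p d ^ 2) := by
  have hD' : IsDiagonalization Z (-d) (B - A) := by simpa using hD.neg
  have row := hA.sum_overlap_right hB
  have col := hA.sum_overlap_left hB
  have sa : vecLpNorm p a ^ p = ∑ i, ∑ j, ‖(Uᴴ * V) i j‖ ^ 2 * |a i| ^ p := by
    simp only [← Finset.sum_mul, row, one_mul, vecLpNorm_rpow hp]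
  have sb : vecLpNorm p b ^ p = ∑ i, ∑ j, ‖(Uᴴ * V) i j‖ ^ 2 * |b j| ^ p := by
    rw [Finset.sum_comm]
    simp only [← Finset.sum_mul, col, one_mul, vecLpNorm_rpow hp]
  have sl : ∑ j, |b j| ^ (p - 2) * b j * ((Vᴴ * (A - B) * V) j j).re
      = ∑ i, ∑ j, ‖(Uᴴ * V) i j‖ ^ 2 * (|b j| ^ (p - 2) * b j * (a i - b j)) := by
    rw [Finset.sum_comm]
    refine Finset.sum_congr rfl fun j _ => ?_
    rw [Matrix.mul_sub, Matrix.sub_mul, Matrix.sub_apply, Complex.sub_re,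
      hB.star_mul_self_apply, hA.star_mul_mul_apply V j]
    have : b j = ∑ i, ‖(Uᴴ * V) i j‖ ^ 2 * b j := by rw [← Finset.sum_mul, col, one_mul]
    conv_lhs => rw [mul_sub]; enter [2, 2]; rw [this]
    rw [← mul_sub, ← Finset.sum_sub_distrib, Finset.mul_sum]
    refine Finset.sum_congr rfl fun i _ => ?_
    rw [norm_overlap_comm U V]
    ring
  have qa : ∑ i, ∑ j, ‖(Uᴴ * V) i j‖ ^ 2 * (|a i| ^ (p - 2) * (a i - b j) ^ 2)
      ≤ vecLpNorm p a ^ (p - 2) * vecLpNorm p d ^ 2 := by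
    have h := hA.holder hD hp two_pos hp
    simp only [Real.rpow_two, sq_abs] at h
    refine le_of_eq_of_le (Finset.sum_congr rfl fun i _ => ?_) h
    rw [← hA.sum_overlap_mul_sq hB hD, Finset.mul_sum]
    exact Finset.sum_congr rfl fun j _ => by ring
  have qb : ∑ i, ∑ j, ‖(Uᴴ * V) i j‖ ^ 2 * (|b j| ^ (p - 2) * (a i - b j) ^ 2)
      ≤ vecLpNorm p b ^ (p - 2) * vecLpNorm p d ^ 2 := by
    have h := hB.holder hD' hp two_pos hp
    simp only [Real.rpow_two, sq_abs, vecLpNorm_neg] at h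
    rw [Finset.sum_comm]
    refine le_of_eq_of_le (Finset.sum_congr rfl fun j _ => ?_) h
    rw [← hB.sum_overlap_mul_sq hA hD', Finset.mul_sum]
    refine Finset.sum_congr rfl fun i _ => ?_
    rw [norm_overlap_comm U V]
    ring
  calc _ = ∑ i, ∑ j, ‖(Uᴴ * V) i j‖ ^ 2
          * (|a i| ^ p - |b j| ^ p - p * (|b j| ^ (p - 2) * b j) * (a i - b j)) := by
        rw [sa, sb, sl]
        simp only [Finset.mul_sum, ← Finset.sum_sub_distrib]
        exact Finset.sum_congr rfl fun i _ => Finset.sum_congr rfl fun j _ => by ring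
    _ ≤ ∑ i, ∑ j, ‖(Uᴴ * V) i j‖ ^ 2
          * (p * (p - 1) * ((|a i| ^ (p - 2) + |b j| ^ (p - 2)) * (a i - b j) ^ 2)) :=
        Finset.sum_le_sum fun i _ => Finset.sum_le_sum fun j _ =>
          mul_le_mul_of_nonneg_left (abs_rpow_taylor hp _ _) (sq_nonneg _)
    _ = p * (p - 1) * (∑ i, ∑ j, ‖(Uᴴ * V) i j‖ ^ 2 * (|a i| ^ (p - 2) * (a i - b j) ^ 2)
          + ∑ i, ∑ j, ‖(Uᴴ * V) i j‖ ^ 2 * (|b j| ^ (p - 2) * (a i - b j) ^ 2)) := by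
        simp only [Finset.mul_sum, ← Finset.sum_add_distrib]
        exact Finset.sum_congr rfl fun i _ => Finset.sum_congr rfl fun j _ => by ring
    _ ≤ _ := by
        refine mul_le_mul_of_nonneg_left ?_ (mul_nonneg (by linarith) (by linarith))
        rw [add_mul]
        exact add_le_add qa qb

/-- Quadratic uniform smoothness of the Schatten norm on Hermitian matrices. -/
lemma vecLpNorm_sq_smoothness {W : Matrix n n ℂ} {c : n → ℝ}
    (hadd : IsDiagonalization U a (A + B)) (hsub : IsDiagonalization V b (A - B))
    (hA : IsDiagonalization W c A) (hB : IsDiagonalization Z d B) {p : ℝ} (hp : 2 ≤ p) :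
    (vecLpNorm p a ^ 2 + vecLpNorm p b ^ 2) / 2 ≤ vecLpNorm p c ^ 2 + 8 * p * vecLpNorm p d ^ 2 := by
  have hsub' : IsDiagonalization V b (A + -B) := by rwa [← sub_eq_add_neg]
  have t1 := hadd.vecLpNorm_add_le hA hB hp
  have t2 := hsub'.vecLpNorm_add_le hA hB.neg hp
  rw [vecLpNorm_neg] at t2
  have s1 := hadd.vecLpNorm_rpow_taylor hA (Z := Z) (d := d) (by simpa using hB) hp
  have s2 := hsub'.vecLpNorm_rpow_taylor hA (Z := Z) (d := -d) (by simpa using hB.neg) hp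
  rw [vecLpNorm_neg] at s2
  simp only [add_sub_cancel_left, Matrix.neg_mul, Matrix.neg_apply,
    Complex.neg_re, mul_neg, Finset.sum_neg_distrib] at s1 s2
  exact sq_smoothness_of_rpow hp (vecLpNorm_nonneg _ _) (vecLpNorm_nonneg _ _) (vecLpNorm_nonneg _ _)
    (vecLpNorm_nonneg _ _) t1 t2 (by linarith)

end IsDiagonalization

/-! ### The Hermitian dilation -/

/-- The Hermitian dilation of a square matrix. -/
def dilation {n : Type*} (x : Matrix n n ℂ) : Matrix (n ⊕ n) (n ⊕ n) ℂ :=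
  fromBlocks 0 x xᴴ 0

lemma isHermitian_dilation {n : Type*} (x : Matrix n n ℂ) : (dilation x).IsHermitian := by
  simp [Matrix.IsHermitian, dilation, fromBlocks_conjTranspose]

lemma dilation_add {n : Type*} (x y : Matrix n n ℂ) :
    dilation (x + y) = dilation x + dilation y := by
  simp [dilation, fromBlocks_add]

lemma dilation_sub {n : Type*} (x y : Matrix n n ℂ) :
    dilation (x - y) = dilation x - dilation y := by
  simp [sub_eq_add_neg, dilation, fromBlocks_add, fromBlocks_neg]

lemma charpoly_dilation_mul_self {n : Type*} [Fintype n] [DecidableEq n] (x : Matrix n n ℂ) :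
    (dilation x * dilation x).charpoly = (xᴴ * x).charpoly * (xᴴ * x).charpoly := by
  simp [dilation, fromBlocks_multiply, charpoly_mul_comm x xᴴ]

lemma singVals_nonneg {k : ℕ} (x : Matrix (Fin k) (Fin k) ℂ) (i : Fin k) : 0 ≤ singVals x i :=
  Real.sqrt_nonneg _

lemma sum_eigenvalues_dilation {k : ℕ} (p : ℝ) (x : Matrix (Fin k) (Fin k) ℂ) :
    ∑ i, |(isHermitian_dilation x).eigenvalues i| ^ p = 2 * ∑ i, singVals x i ^ p := by
  have hx := Matrix.posSemidef_conjTranspose_mul_self x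
  have h1 := (IsDiagonalization.of_isHermitian (isHermitian_dilation x)).mul_self.roots_charpoly
  have h2 := (IsDiagonalization.of_isHermitian hx.1).roots_charpoly
  have hne : (xᴴ * x).charpoly * (xᴴ * x).charpoly ≠ 0 :=
    mul_ne_zero (charpoly_monic _).ne_zero (charpoly_monic _).ne_zero
  rw [charpoly_dilation_mul_self, Polynomial.roots_mul hne, h2] at h1
  have h3 := congrArg (fun s : Multiset ℂ => (s.map fun z => Real.sqrt z.re ^ p).sum) h1
  simp only [Multiset.map_add, Multiset.sum_add, Multiset.map_map, Function.comp_def,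
    Complex.ofReal_re, Real.sqrt_sq_eq_abs] at h3
  rw [two_mul]
  exact h3.symm

lemma vecLpNorm_eigenvalues_dilation {k : ℕ} (p : ℝ) (x : Matrix (Fin k) (Fin k) ℂ) :
    vecLpNorm p (isHermitian_dilation x).eigenvalues = 2 ^ (1 / p) * schattenNorm p x := by
  rw [vecLpNorm, sum_eigenvalues_dilation, schattenNorm, Real.mul_rpow zero_le_two]
  exact Finset.sum_nonneg fun i _ => Real.rpow_nonneg (singVals_nonneg x i) _

/-- Quadratic uniform smoothness of the Schatten norm. -/
lemma schattenNorm_sq_smoothness {k : ℕ} {p : ℝ} (hp : 2 ≤ p) (x y : Matrix (Fin k) (Fin k) ℂ) :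
    (schattenNorm p (x + y) ^ 2 + schattenNorm p (x - y) ^ 2) / 2
      ≤ schattenNorm p x ^ 2 + 8 * p * schattenNorm p y ^ 2 := by
  have hadd := IsDiagonalization.of_isHermitian (isHermitian_dilation (x + y))
  have hsub := IsDiagonalization.of_isHermitian (isHermitian_dilation (x - y))
  have h := IsDiagonalization.vecLpNorm_sq_smoothness (hadd.congr (dilation_add x y))
    (hsub.congr (dilation_sub x y)) (.of_isHermitian (isHermitian_dilation x))
    (.of_isHermitian (isHermitian_dilation y)) hp
  simp only [vecLpNorm_eigenvalues_dilation, mul_pow] at h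
  have h2 : (0 : ℝ) < (2 ^ (1 / p)) ^ 2 := by positivity
  refine le_of_mul_le_mul_left ?_ h2
  linarith

lemma schattenNorm_zero {k : ℕ} {p : ℝ} (hp : 2 ≤ p) :
    schattenNorm p (0 : Matrix (Fin k) (Fin k) ℂ) = 0 := by
  have hs : ∀ i, singVals (0 : Matrix (Fin k) (Fin k) ℂ) i = 0 := by
    intro i
    have h := (Matrix.posSemidef_conjTranspose_mul_self
      (0 : Matrix (Fin k) (Fin k) ℂ)).1.eigenvalues_eq_zero_iff.2 (by simp)
    rw [singVals, h]
    simp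
  simp [schattenNorm, hs, Real.zero_rpow (show p ≠ 0 by linarith),
    Real.zero_rpow (show p⁻¹ ≠ 0 from inv_ne_zero (by linarith))]

/-! ### From uniform smoothness to type 2 -/

/-- A quadratic uniform smoothness inequality implies a type 2 inequality. -/
lemma sum_signs_sq_le_of_smoothness {E : Type*} [AddCommGroup E] [Module ℂ E] {N : E → ℝ} {K : ℝ}
    (hN0 : N 0 = 0) (hN : ∀ x y, (N (x + y) ^ 2 + N (x - y) ^ 2) / 2 ≤ N x ^ 2 + K * N y ^ 2)
    (m : ℕ) (x : Fin m → E) :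
    (∑ ε : Fin m → Bool, N (∑ i, (if ε i then (1 : ℂ) else -1) • x i) ^ 2) / 2 ^ m
      ≤ K * ∑ i, N (x i) ^ 2 := by
  induction m with
  | zero => simp [hN0]
  | succ m ih =>
    rw [← (Fin.consEquiv fun _ => Bool).sum_comp, Fintype.sum_prod_type, Fintype.sum_bool,
      ← Finset.sum_add_distrib, Fin.sum_univ_succ, pow_succ, mul_add]
    simp only [Fin.consEquiv_apply, Fin.sum_univ_succ, Fin.cons_zero, Fin.cons_succ, if_true,
      Bool.false_eq_true, if_false, one_smul, neg_smul]
    have h := ih fun i => x i.succ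
    rw [div_le_iff₀ (by positivity)] at h ⊢
    have step : ∀ ε : Fin m → Bool,
        N (x 0 + ∑ i : Fin m, (if ε i then (1 : ℂ) else -1) • x i.succ) ^ 2
          + N (-x 0 + ∑ i : Fin m, (if ε i then (1 : ℂ) else -1) • x i.succ) ^ 2
        ≤ 2 * N (∑ i : Fin m, (if ε i then (1 : ℂ) else -1) • x i.succ) ^ 2
          + 2 * (K * N (x 0) ^ 2) := by
      intro ε
      have := hN (∑ i : Fin m, (if ε i then (1 : ℂ) else -1) • x i.succ) (x 0)
      rw [add_comm (x 0), neg_add_eq_sub]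
      linarith
    refine (Finset.sum_le_sum fun ε _ => step ε).trans ?_
    rw [Finset.sum_add_distrib, ← Finset.mul_sum]
    simp only [Finset.sum_const, Finset.card_univ, Fintype.card_fun, Fintype.card_bool,
      Fintype.card_fin, nsmul_eq_mul]
    push_cast
    linarith

/-- the Rademacher type 2 constant of the Schatten `p`-class `C^k_p`
satisfies `T₂(C^k_p) ≤ C √p` for `2 ≤ p < ∞`, with a universal constant `C`. -/
theorem type_two_constant_schatten_class :
    ∃ C : ℝ, 0 < C ∧ ∀ (k : ℕ) (p : ℝ), 2 ≤ p →
      ∀ (m : ℕ) (x : Fin m → Matrix (Fin k) (Fin k) ℂ),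
        (∑ ε : Fin m → Bool,
            schattenNorm p (∑ i : Fin m, (if ε i then (1 : ℂ) else -1) • x i) ^ 2) / 2 ^ m
          ≤ (C * Real.sqrt p) ^ 2 * ∑ i : Fin m, schattenNorm p (x i) ^ 2 := by
  refine ⟨Real.sqrt 8, by positivity, fun k p hp m x => ?_⟩
  rw [mul_pow, Real.sq_sqrt (by norm_num), Real.sq_sqrt (by linarith)]
  exact sum_signs_sq_le_of_smoothness (schattenNorm_zero hp) (schattenNorm_sq_smoothness hp) m x
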